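/- (Equality case of the algebraic DDVV inequality.) Assume m ≥ 2. For β ∈ Sym(V×V,W) and c ∈ ℝ, equality ρ_c(β) = c + H_β² − ρ⊥(β) holds if and only if there exist orthonormal bases {e_i}_{1≤i≤n} of V and {ξ_a}_{1≤a≤m} of W and real numbers μ, λ₁, …, λ_m such that: A_{ξ₁}(β)e₁ = (λ₁+μ)e₁, A_{ξ₁}(β)e₂ = (λ₁−μ)e₂, A_{ξ₁}(β)e_i = λ₁e_i for 3 ≤ i ≤ n; A_{ξ₂}(β)e₁ = λ₂e₁ + μe₂, A_{ξ₂}(β)e₂ = μe₁ + λ₂e₂, A_{ξ₂}(β)e_i = λ₂e_i for 3 ≤ i ≤ n; and A_{ξ_a}(β) = λ_a·Id_V for 3 ≤ a ≤ m. -/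

import Mathlib

open scoped RealInnerProductSpace BigOperators
open MeasureTheory Classical

namespace Paper

variable {V W : Type*} [NormedAddCommGroup V] [InnerProductSpace ℝ V]
  [NormedAddCommGroup W] [InnerProductSpace ℝ W]

/-- `β` is a symmetric bilinear map. -/
def IsSymmBil (β : V →ₗ[ℝ] V →ₗ[ℝ] W) : Prop := ∀ x y, β x y = β y x

/-- The formal shape operator `A_ξ(β)`, determined by `⟪β x y, ξ⟫ = ⟪A_ξ(β) x, y⟫`. -/
noncomputable def shapeOp (β : V →ₗ[ℝ] V →ₗ[ℝ] W) (ξ : W) : V →ₗ[ℝ] V :=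
  if h : ∃ A : V →ₗ[ℝ] V, ∀ x y : V, ⟪β x y, ξ⟫ = ⟪A x, y⟫ then h.choose else 0

variable {n m : ℕ}

/-- The mean curvature vector `𝓗_β = (1/n) Σ_i β(e_i, e_i)`. -/
noncomputable def meanCurv (e : OrthonormalBasis (Fin n) ℝ V)
    (β : V →ₗ[ℝ] V →ₗ[ℝ] W) : W :=
  (n : ℝ)⁻¹ • ∑ i, β (e i) (e i)

/-- The formal Ricci tensor `Ric_c(β)`. -/
noncomputable def ric (c : ℝ) (e : OrthonormalBasis (Fin n) ℝ V)
    (β : V →ₗ[ℝ] V →ₗ[ℝ] W) (x y : V) : ℝ :=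
  c * (n - 1) * ⟪x, y⟫ + n * ⟪meanCurv e β, β x y⟫
    - ∑ i, ⟪β x (e i), β y (e i)⟫

/-- The normalized scalar curvature `ρ_c(β) = (1/(n(n-1))) tr Ric_c(β)`. -/
noncomputable def rho (c : ℝ) (e : OrthonormalBasis (Fin n) ℝ V)
    (β : V →ₗ[ℝ] V →ₗ[ℝ] W) : ℝ :=
  (n * (n - 1) : ℝ)⁻¹ * ∑ i, ric c e β (e i) (e i)

/-- The self-adjoint operator `T_c(β)` with `⟪T_c(β) x, y⟫ = (1/(n-1)) Ric_c(β)(x,y)`. -/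
noncomputable def ricOp (c : ℝ) (e : OrthonormalBasis (Fin n) ℝ V)
    (β : V →ₗ[ℝ] V →ₗ[ℝ] W) : V →ₗ[ℝ] V :=
  if h : ∃ T : V →ₗ[ℝ] V, ∀ x y : V, ⟪T x, y⟫ = (n - 1 : ℝ)⁻¹ * ric c e β x y
  then h.choose else 0

/-- The increasingly ordered eigenvalues of an endomorphism admitting an orthonormal
eigenbasis (junk value otherwise). -/
noncomputable def sortedEigs (n : ℕ) (T : V →ₗ[ℝ] V) : Fin n → ℝ :=
  if h : ∃ μ : Fin n → ℝ, Monotone μ ∧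
      ∃ b : OrthonormalBasis (Fin n) ℝ V, ∀ i, T (b i) = μ i • b i
  then h.choose else fun _ => 0

/-- The `k`-th scalar curvature `ρ_{c,k}(β) = (1/k) Σ_{i=1}^k λ_{c,i}(β)`. -/
noncomputable def rhoK (c : ℝ) (k : ℕ) (e : OrthonormalBasis (Fin n) ℝ V)
    (β : V →ₗ[ℝ] V →ₗ[ℝ] W) : ℝ :=
  (k : ℝ)⁻¹ * ∑ i ∈ Finset.univ.filter (fun i : Fin n => (i : ℕ) < k),
    sortedEigs n (ricOp c e β) i

/-- The normal scalar curvature `ρ⊥(β)`. -/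
noncomputable def rhoPerp (e : OrthonormalBasis (Fin n) ℝ V)
    (ξ : OrthonormalBasis (Fin m) ℝ W) (β : V →ₗ[ℝ] V →ₗ[ℝ] W) : ℝ :=
  (n * (n - 1) : ℝ)⁻¹ * Real.sqrt (∑ a, ∑ b, ∑ i,
    ‖(shapeOp β (ξ a) ∘ₗ shapeOp β (ξ b) - shapeOp β (ξ b) ∘ₗ shapeOp β (ξ a)) (e i)‖ ^ 2)

/-- The index of a self-adjoint endomorphism: the number of negative eigenvalues,
counted with multiplicity. -/
noncomputable def negIndex (n : ℕ) (T : V →ₗ[ℝ] V) : ℕ :=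
  (Finset.univ.filter (fun i : Fin n => sortedEigs n T i < 0)).card

/-- The Hilbert–Schmidt norm `‖β‖² = Σ_{i,j} ‖β(e_i,e_j)‖²`. -/
noncomputable def normHS (e : OrthonormalBasis (Fin n) ℝ V)
    (β : V →ₗ[ℝ] V →ₗ[ℝ] W) : ℝ :=
  Real.sqrt (∑ i, ∑ j, ‖β (e i) (e j)‖ ^ 2)

/-- `ψ_p(β) = ∫_{Λ_p(β)} |det A_u(β)| dS_u` over the unit sphere of `W = ℝ^m`. -/
noncomputable def psi (n m p : ℕ)
    (β : EuclideanSpace ℝ (Fin n) →ₗ[ℝ] EuclideanSpace ℝ (Fin n) →ₗ[ℝ]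
      EuclideanSpace ℝ (Fin m)) : ℝ :=
  ∫ u in {u : Metric.sphere (0 : EuclideanSpace ℝ (Fin m)) 1 |
      p < negIndex n (shapeOp β (u : EuclideanSpace ℝ (Fin m))) ∧
      negIndex n (shapeOp β (u : EuclideanSpace ℝ (Fin m))) < n - p},
    |LinearMap.det (shapeOp β (u : EuclideanSpace ℝ (Fin m)))|
    ∂((volume : Measure (EuclideanSpace ℝ (Fin m))).toSphere)


theorem sub_sq_le_one_or_exists_center {ι : Type*} [Fintype ι] {η : ι → ℝ}
    (hη : ∑ u, η u ^ 2 = 1) :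
    (∀ u v, (η u - η v) ^ 2 ≤ 1) ∨
      ∃ p, ∀ u v, 1 ≤ (η u - η v) ^ 2 → u = p ∨ v = p := by
  by_contra! h
  obtain ⟨⟨u₀, v₀, h₀⟩, hc⟩ := h
  have : Nonempty ι := ⟨u₀⟩
  obtain ⟨p, hp⟩ := Finite.exists_max η
  obtain ⟨q, hq⟩ := Finite.exists_min η
  have hpq : 1 < η p - η q := by
    have h1 := hp u₀; have h2 := hp v₀; have h3 := hq u₀; have h4 := hq v₀
    have : 1 < |η u₀ - η v₀| := by
      by_contra! h; nlinarith [sq_abs (η u₀ - η v₀), abs_nonneg (η u₀ - η v₀)]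
    rcases lt_abs.1 this with h | h <;> linarith
  have two : ∀ u v, u ≠ v → η u ^ 2 + η v ^ 2 ≤ 1 := fun u v huv => by
    rw [← hη, ← Finset.sum_pair (f := fun i => η i ^ 2) huv]
    exact Finset.sum_le_sum_of_subset_of_nonneg (Finset.subset_univ _) fun _ _ _ => sq_nonneg _
  have four : ∀ u v, p ≠ u → p ≠ v → q ≠ u → q ≠ v → u ≠ v → p ≠ q →
      η p ^ 2 + η q ^ 2 + η u ^ 2 + η v ^ 2 ≤ 1 := fun u v h1 h2 h3 h4 h5 h6 => by
    have : ∑ i ∈ {p, q, u, v}, η i ^ 2 = η p ^ 2 + (η q ^ 2 + (η u ^ 2 + η v ^ 2)) := by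
      rw [Finset.sum_insert (by simp [*]), Finset.sum_insert (by simp [*]), Finset.sum_pair h5]
    have h := Finset.sum_le_sum_of_subset_of_nonneg (f := fun i => η i ^ 2)
      (Finset.subset_univ {p, q, u, v}) fun _ _ _ => sq_nonneg _
    linarith
  have hne : p ≠ q := by rintro rfl; linarith
  have key : ∀ w, w ≠ p → w ≠ q → ∀ w', w' ≠ p → w' ≠ q → (η w - η w') ^ 2 < 1 := by
    intro w h1 h2 w' h3 h4
    by_cases hw : w = w'
    · simp [hw]
    have := four w w' h1.symm h3.symm h2.symm h4.symm hw hne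
    nlinarith [sq_nonneg (η p + η q), sq_nonneg (η w + η w')]
  obtain ⟨a, b, hab, ha, hb⟩ := hc p
  obtain ⟨a', b', hab', ha', hb'⟩ := hc q
  -- an edge avoiding `p` contains `q`, and conversely
  obtain ⟨u, hup, hu⟩ : ∃ u, u ≠ p ∧ 1 ≤ (η u - η q) ^ 2 := by
    by_cases h1 : a = q
    · exact ⟨b, hb, by subst h1; nlinarith⟩
    by_cases h2 : b = q
    · exact ⟨a, ha, by subst h2; nlinarith⟩
    exact absurd hab (not_le.2 (key a ha h1 b hb h2))
  obtain ⟨v, hvq, hv⟩ : ∃ v, v ≠ q ∧ 1 ≤ (η p - η v) ^ 2 := by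
    by_cases h1 : a' = p
    · exact ⟨b', hb', by subst h1; nlinarith⟩
    by_cases h2 : b' = p
    · exact ⟨a', ha', by subst h2; nlinarith⟩
    exact absurd hab' (not_le.2 (key a' h1 ha' b' h2 hb'))
  have hu1 : 1 ≤ η u - η q := by nlinarith [hq u]
  have hv1 : 1 ≤ η p - η v := by nlinarith [hp v]
  have huq : u ≠ q := by rintro rfl; linarith
  have hvp : v ≠ p := by rintro rfl; linarith
  by_cases huv : u = v
  · subst huv
    nlinarith [two p q hne, sq_nonneg (η p + η q)]
  · have := four u v hup.symm hvp.symm huq.symm hvq.symm huv hne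
    have e1 : η p - η v = 1 := by
      nlinarith [sq_nonneg (η p + η v), sq_nonneg (η u + η q)]
    have e2 : η u - η q = 1 := by
      nlinarith [sq_nonneg (η p + η v), sq_nonneg (η u + η q)]
    have e3 : η p + η v = 0 := by
      have : (η p + η v) ^ 2 ≤ 0 := by nlinarith [sq_nonneg (η u + η q)]
      nlinarith
    have e4 : η u + η q = 0 := by
      have : (η u + η q) ^ 2 ≤ 0 := by nlinarith [sq_nonneg (η p + η v)]
      nlinarith
    linarith

theorem sum_sub_sq_sub_one_le {ι : Type*} [Fintype ι] {η : ι → ℝ}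
    (hη : ∑ u, η u ^ 2 = 1) {p : ι} {Q : Finset ι} (hp : p ∉ Q) :
    ∑ q ∈ Q, ((η p - η q) ^ 2 - 1) ≤ 1 := by
  have h1 : η p ^ 2 + ∑ q ∈ Q, η q ^ 2 ≤ 1 := by
    rw [← hη, ← Finset.sum_insert (f := fun i => η i ^ 2) hp]
    exact Finset.sum_le_sum_of_subset_of_nonneg (Finset.subset_univ _) fun _ _ _ => sq_nonneg _
  have h2 : (∑ q ∈ Q, η q) ^ 2 ≤ Q.card * ∑ q ∈ Q, η q ^ 2 := sq_sum_le_card_mul_sum_sq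
  have h3 : ∑ q ∈ Q, ((η p - η q) ^ 2 - 1) =
      Q.card * (η p ^ 2 - 1) - 2 * η p * ∑ q ∈ Q, η q + ∑ q ∈ Q, η q ^ 2 := by
    simp only [sub_sq, Finset.sum_sub_distrib, Finset.sum_add_distrib, Finset.sum_const,
      nsmul_eq_mul, ← Finset.mul_sum]
    ring
  have h4 : (0 : ℝ) ≤ Q.card * (1 - (η p ^ 2 + ∑ q ∈ Q, η q ^ 2)) :=
    mul_nonneg (Nat.cast_nonneg _) (by linarith)
  rw [h3]
  nlinarith [sq_nonneg (η p + ∑ q ∈ Q, η q)]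

theorem sum_sub_sq_sub_one_mul_le {ι : Type*} [Fintype ι] {η : ι → ℝ}
    (hη : ∑ u, η u ^ 2 = 1) {x : ι → ι → ℝ} (hx₀ : ∀ u v, 0 ≤ x u v)
    (hx : ∀ u v, u ≠ v → x u v ≤ 1 / 2) :
    ∑ u, ∑ v, ((η u - η v) ^ 2 - 1) * x u v ≤ 1 ∧
      (∑ u, ∑ v, ((η u - η v) ^ 2 - 1) * x u v = 1 →
        ∃ p, ∀ u v, x u v ≠ 0 → 1 ≤ (η u - η v) ^ 2 ∧ (u = p ∨ v = p)) := by
  rcases sub_sq_le_one_or_exists_center hη with h | ⟨p, hp⟩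
  · have : ∑ u, ∑ v, ((η u - η v) ^ 2 - 1) * x u v ≤ 0 :=
      Finset.sum_nonpos fun u _ => Finset.sum_nonpos fun v _ =>
        mul_nonpos_of_nonpos_of_nonneg (by linarith [h u v]) (hx₀ u v)
    exact ⟨by linarith, fun h => by linarith⟩
  set g : ι → ι → ℝ := fun u v => if 1 ≤ (η u - η v) ^ 2 then ((η u - η v) ^ 2 - 1) / 2 else 0
    with hg
  have hle : ∀ u v, ((η u - η v) ^ 2 - 1) * x u v ≤ g u v := by
    intro u v
    simp only [hg]
    split_ifs with h
    · have : u ≠ v := by rintro rfl; norm_num at h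
      nlinarith [hx u v this]
    · exact mul_nonpos_of_nonpos_of_nonneg (by linarith) (hx₀ u v)
  have hgp : g p p = 0 := by simp [hg]
  have hsum : ∑ u, ∑ v, g u v = ∑ q with 1 ≤ (η p - η q) ^ 2, ((η p - η q) ^ 2 - 1) := by
    have h1 : ∀ u v, g u v = (if u = p then g p v else 0) + (if v = p then g p u else 0) := by
      intro u v
      have hsymm : g u v = g v u := by simp only [hg, sub_sq_comm (η u)]
      by_cases hu : u = p
      · by_cases hv : v = p
        · simp [hu, hv, hgp]
        · simp [hu, hv]
      · by_cases hv : v = p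
        · rw [hsymm]; simp [hu, hv]
        · have : ¬ 1 ≤ (η u - η v) ^ 2 := fun h => (hp u v h).elim hu hv
          simp only [hu, hv, if_false, hg, if_neg this, add_zero]
    rw [Finset.sum_congr rfl fun u _ => Finset.sum_congr rfl fun v _ => h1 u v]
    simp only [Finset.sum_add_distrib]
    rw [Finset.sum_comm]
    simp only [Finset.sum_ite_eq', Finset.mem_univ, if_true]
    rw [← two_mul, Finset.mul_sum, Finset.sum_filter]
    refine Finset.sum_congr rfl fun q _ => ?_
    simp only [hg]
    split_ifs <;> ring
  have hone : ∑ u, ∑ v, g u v ≤ 1 := by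
    rw [hsum]
    exact sum_sub_sq_sub_one_le hη (by simp)
  have hle' : ∀ u, ∑ v, ((η u - η v) ^ 2 - 1) * x u v ≤ ∑ v, g u v := fun u =>
    Finset.sum_le_sum fun v _ => hle u v
  have hsle := Finset.sum_le_sum fun u (_ : u ∈ Finset.univ) => hle' u
  refine ⟨hsle.trans hone, fun heq => ⟨p, fun u v hne => ?_⟩⟩
  have e1 := (Finset.sum_eq_sum_iff_of_le fun u _ => hle' u).1
    (le_antisymm hsle (hone.trans heq.ge)) u (Finset.mem_univ _)
  have e2 := (Finset.sum_eq_sum_iff_of_le fun v _ => hle u v).1 e1 v (Finset.mem_univ _)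
  have h1 : 1 ≤ (η u - η v) ^ 2 := by
    by_contra h
    simp only [hg, if_neg h] at e2
    rcases mul_eq_zero.1 e2 with h' | h'
    · linarith
    · exact hne h'
  exact ⟨h1, hp u v h1⟩

/-- Equality in the Schur-type estimate for a symmetric matrix whose rows satisfy
`∑ j ∈ J, (c i j - 1) ≤ 1`. -/
theorem eq_of_sq_sum_eq_sum_mul {ι : Type*} [Fintype ι] {a : ι → ℝ} {c : ι → ι → ℝ}
    (ha : ∀ i, 0 < a i) (hc : ∀ i j, c i j = c j i) (hc₀ : ∀ i, c i i = 0)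
    (hJ : ∀ i (J : Finset ι), i ∉ J → ∑ j ∈ J, (c i j - 1) ≤ 1)
    (h : (∑ i, a i) ^ 2 = ∑ i, ∑ j, c i j * (a i * a j)) :
    (∀ i, ∑ j ∈ Finset.univ.erase i, (c i j - 1) = 1) ∧
      ∀ i j, 1 < c i j → a i = a j := by
  set w : ι → ι → ℝ := fun i j => max (c i j - 1) 0 with hw
  have hw0 : ∀ i j, 0 ≤ w i j := fun i j => le_max_right _ _
  have hwc : ∀ i j, c i j - 1 ≤ w i j := fun i j => le_max_left _ _
  have hwii : ∀ i, w i i = 0 := fun i => by simp [hw, hc₀]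
  have hwrow : ∀ i, ∑ j, w i j ≤ 1 := by
    intro i
    have : ∑ j, w i j = ∑ j with 1 < c i j, (c i j - 1) := by
      rw [Finset.sum_filter]
      refine Finset.sum_congr rfl fun j _ => ?_
      split_ifs with h
      · exact max_eq_left (by linarith)
      · exact max_eq_right (by linarith)
    rw [this]
    exact hJ i _ (by simp [hc₀])
  set d : ι → ι → ℝ := fun i j => if i = j then 0 else w i j - (c i j - 1) with hd
  have hd0 : ∀ i j, 0 ≤ d i j := fun i j => by
    simp only [hd]; split_ifs
    · exact le_rfl
    · linarith [hwc i j]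
  have hT1 : 0 ≤ ∑ i, ∑ j, d i j * (a i * a j) :=
    Finset.sum_nonneg fun i _ => Finset.sum_nonneg fun j _ =>
      mul_nonneg (hd0 i j) (mul_pos (ha i) (ha j)).le
  have hT2 : 0 ≤ ∑ i, a i ^ 2 * (1 - ∑ j, w i j) :=
    Finset.sum_nonneg fun i _ => mul_nonneg (sq_nonneg _) (by linarith [hwrow i])
  have hT3 : 0 ≤ ∑ i, ∑ j, w i j * (a i - a j) ^ 2 :=
    Finset.sum_nonneg fun i _ => Finset.sum_nonneg fun j _ =>
      mul_nonneg (hw0 i j) (sq_nonneg _)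
  have hsum : (∑ i, ∑ j, d i j * (a i * a j)) + (∑ i, a i ^ 2 * (1 - ∑ j, w i j))
      + (∑ i, ∑ j, w i j * (a i - a j) ^ 2) / 2 = 0 := by
    have e1 : ∑ i, ∑ j, d i j * (a i * a j) =
        ∑ i, ∑ j, w i j * (a i * a j) - ∑ i, ∑ j, c i j * (a i * a j)
          + (∑ i, a i) ^ 2 - ∑ i, a i ^ 2 := by
      have : ∀ i j, d i j * (a i * a j) = w i j * (a i * a j) - c i j * (a i * a j) + a i * a j
          - if i = j then a i ^ 2 else 0 := by
        intro i j
        simp only [hd]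
        split_ifs with hij
        · subst hij; rw [hwii, hc₀]; ring
        · ring
      simp_rw [this, Finset.sum_sub_distrib, Finset.sum_add_distrib, Finset.sum_sub_distrib,
        Finset.sum_ite_eq, Finset.mem_univ, if_true, ← Finset.sum_mul_sum, sq (∑ i, a i)]
    have e2 : ∑ i, ∑ j, w i j * (a i - a j) ^ 2 =
        2 * (∑ i, ∑ j, w i j * a i ^ 2) - 2 * ∑ i, ∑ j, w i j * (a i * a j) := by
      have s : ∑ i, ∑ j, w i j * a j ^ 2 = ∑ i, ∑ j, w i j * a i ^ 2 := by
        rw [Finset.sum_comm]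
        refine Finset.sum_congr rfl fun i _ => Finset.sum_congr rfl fun j _ => ?_
        simp only [hw, hc j i]
      have : ∀ i j, w i j * (a i - a j) ^ 2 =
          w i j * a i ^ 2 + w i j * a j ^ 2 - 2 * (w i j * (a i * a j)) := fun i j => by ring
      simp_rw [this, Finset.sum_sub_distrib, Finset.sum_add_distrib, s, ← Finset.mul_sum]
      ring
    have e3 : ∑ i, a i ^ 2 * (1 - ∑ j, w i j) =
        ∑ i, a i ^ 2 - ∑ i, ∑ j, w i j * a i ^ 2 := by
      rw [← Finset.sum_sub_distrib]
      refine Finset.sum_congr rfl fun i _ => ?_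
      rw [← Finset.sum_mul]; ring
    rw [e1, e2, e3, ← h]; ring
  have z1 : ∑ i, ∑ j, d i j * (a i * a j) = 0 := by linarith
  have z2 : ∑ i, a i ^ 2 * (1 - ∑ j, w i j) = 0 := by linarith
  have z3 : ∑ i, ∑ j, w i j * (a i - a j) ^ 2 = 0 := by linarith
  have y1 : ∀ i j, i ≠ j → c i j - 1 = w i j := by
    intro i j hij
    have h1 := (Finset.sum_eq_zero_iff_of_nonneg fun i _ => Finset.sum_nonneg fun j _ =>
      mul_nonneg (hd0 i j) (mul_pos (ha i) (ha j)).le).1 z1 i (Finset.mem_univ _)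
    have h2 := (Finset.sum_eq_zero_iff_of_nonneg fun j _ =>
      mul_nonneg (hd0 i j) (mul_pos (ha i) (ha j)).le).1 h1 j (Finset.mem_univ _)
    have h3 := (mul_eq_zero.1 h2).resolve_right (mul_pos (ha i) (ha j)).ne'
    simp only [hd, if_neg hij] at h3
    linarith
  constructor
  · intro i
    have h1 := (Finset.sum_eq_zero_iff_of_nonneg fun i _ =>
      mul_nonneg (sq_nonneg (a i)) (by linarith [hwrow i])).1 z2 i (Finset.mem_univ _)
    have h2 := (mul_eq_zero.1 h1).resolve_left (pow_pos (ha i) 2).ne'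
    rw [Finset.sum_congr rfl fun j hj => y1 i j (Finset.ne_of_mem_erase hj).symm]
    rw [← Finset.add_sum_erase _ _ (Finset.mem_univ i), hwii] at h2
    linarith
  · intro i j hij
    have h1 := (Finset.sum_eq_zero_iff_of_nonneg fun i _ => Finset.sum_nonneg fun j _ =>
      mul_nonneg (hw0 i j) (sq_nonneg (a i - a j))).1 z3 i (Finset.mem_univ _)
    have h2 := (Finset.sum_eq_zero_iff_of_nonneg fun j _ =>
      mul_nonneg (hw0 i j) (sq_nonneg (a i - a j))).1 h1 j (Finset.mem_univ _)
    have h3 : w i j ≠ 0 := by have := hwc i j; intro h; linarith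
    have := pow_eq_zero_iff (two_ne_zero) |>.1 ((mul_eq_zero.1 h2).resolve_left h3)
    linarith

/-- Bessel's inequality for an orthonormal family of symmetric matrices, tested against an
off-diagonal entry. -/
theorem sum_sq_entry_le_half {ι κ : Type*} [Fintype ι] {J : Finset κ} {B : κ → ι → ι → ℝ}
    (hB : ∀ j u v, B j u v = B j v u)
    (ho : ∀ j ∈ J, ∀ k ∈ J, ∑ u, ∑ v, B j u v * B k u v = if j = k then 1 else 0)
    {p q : ι} (hpq : p ≠ q) : ∑ j ∈ J, B j p q ^ 2 ≤ 1 / 2 := by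
  set x := ∑ j ∈ J, B j p q ^ 2 with hx
  set f : ι → ι → ℝ := fun u v => ∑ j ∈ J, B j p q * B j u v with hf
  have h1 : ∑ u, ∑ v, f u v ^ 2 = x := by
    have : ∀ u v, f u v ^ 2 = ∑ j ∈ J, ∑ k ∈ J, B j p q * B k p q * (B j u v * B k u v) := by
      intro u v
      rw [sq, hf, Finset.sum_mul_sum]
      exact Finset.sum_congr rfl fun j _ => Finset.sum_congr rfl fun k _ => by ring
    simp_rw [this]
    calc _ = ∑ j ∈ J, ∑ k ∈ J, B j p q * B k p q * ∑ u, ∑ v, B j u v * B k u v := by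
          simp_rw [Finset.mul_sum]
          rw [Finset.sum_congr rfl fun u _ => Finset.sum_comm, Finset.sum_comm]
          refine Finset.sum_congr rfl fun j _ => ?_
          rw [Finset.sum_congr rfl fun u _ => Finset.sum_comm, Finset.sum_comm]
      _ = x := by
          refine Finset.sum_congr rfl fun j hj => ?_
          rw [Finset.sum_congr rfl fun k hk => by rw [ho j hj k hk]]
          simp [hj, sq]
  have h2 : f p q = x := Finset.sum_congr rfl fun j _ => by ring
  have h3 : f q p = x := Finset.sum_congr rfl fun j _ => by rw [hB j q p]; ring
  have h4 : f p q ^ 2 + f q p ^ 2 ≤ ∑ u, ∑ v, f u v ^ 2 := by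
    have hr : ∀ u v, f u v ^ 2 ≤ ∑ v, f u v ^ 2 := fun u v =>
      Finset.single_le_sum (f := fun v => f u v ^ 2) (fun _ _ => sq_nonneg _) (Finset.mem_univ v)
    refine (add_le_add (hr p q) (hr q p)).trans ?_
    rw [← Finset.sum_pair (f := fun u => ∑ v, f u v ^ 2) hpq]
    exact Finset.sum_le_sum_of_subset_of_nonneg (Finset.subset_univ _) fun _ _ _ =>
      Finset.sum_nonneg fun _ _ => sq_nonneg _
  rw [h1, h2, h3] at h4
  have : 0 ≤ x := Finset.sum_nonneg fun _ _ => sq_nonneg _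
  by_contra! h
  nlinarith

theorem sum_weighted_sq_sub_one_le {ι κ : Type*} [Fintype ι] {J : Finset κ} {η : ι → ℝ}
    {B : κ → ι → ι → ℝ} (hη : ∑ u, η u ^ 2 = 1) (hB : ∀ j u v, B j u v = B j v u)
    (ho : ∀ j ∈ J, ∀ k ∈ J, ∑ u, ∑ v, B j u v * B k u v = if j = k then 1 else 0) :
    ∑ j ∈ J, (∑ u, ∑ v, (η u - η v) ^ 2 * B j u v ^ 2 - 1) ≤ 1 ∧
      (∑ j ∈ J, (∑ u, ∑ v, (η u - η v) ^ 2 * B j u v ^ 2 - 1) = 1 →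
        ∃ p, ∀ j ∈ J, ∀ u v, B j u v ≠ 0 → 1 ≤ (η u - η v) ^ 2 ∧ (u = p ∨ v = p)) := by
  have hx := sum_sub_sq_sub_one_mul_le hη (x := fun u v => ∑ j ∈ J, B j u v ^ 2)
    (fun _ _ => Finset.sum_nonneg fun _ _ => sq_nonneg _)
    (fun u v huv => sum_sq_entry_le_half hB ho huv)
  have e : ∑ j ∈ J, (∑ u, ∑ v, (η u - η v) ^ 2 * B j u v ^ 2 - 1) =
      ∑ u, ∑ v, ((η u - η v) ^ 2 - 1) * ∑ j ∈ J, B j u v ^ 2 := by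
    simp_rw [Finset.mul_sum]
    rw [Finset.sum_congr rfl fun u _ => Finset.sum_comm, Finset.sum_comm]
    refine Finset.sum_congr rfl fun j hj => ?_
    have h1 := ho j hj j hj
    simp only [if_true, ← sq] at h1
    simp only [sub_mul, one_mul, Finset.sum_sub_distrib, h1]
  rw [e]
  refine ⟨hx.1, fun h => ?_⟩
  obtain ⟨p, hp⟩ := hx.2 h
  refine ⟨p, fun j hj u v hne => hp u v fun h0 => hne ?_⟩
  have := (Finset.sum_eq_zero_iff_of_nonneg fun j _ => sq_nonneg (B j u v)).1 h0 j hj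
  exact pow_eq_zero_iff two_ne_zero |>.1 this

theorem sum_inner_map_eq {ι κ : Type*} [Fintype ι] [Fintype κ]
    (b : OrthonormalBasis ι ℝ V) (b' : OrthonormalBasis κ ℝ V) (S T : V →ₗ[ℝ] W) :
    ∑ i, ⟪S (b i), T (b i)⟫ = ∑ j, ⟪S (b' j), T (b' j)⟫ := by
  have h1 : ∀ i, ⟪S (b i), T (b i)⟫ =
      ∑ j, ∑ k, ⟪b' j, b i⟫ * ⟪b i, b' k⟫ * ⟪S (b' j), T (b' k)⟫ := by
    intro i
    conv_lhs => rw [← b'.sum_repr' (b i)]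
    simp only [map_sum, map_smul, sum_inner, inner_sum, real_inner_smul_left,
      real_inner_smul_right]
    rw [Finset.sum_comm]
    refine Finset.sum_congr rfl fun j _ => Finset.sum_congr rfl fun k _ => ?_
    rw [real_inner_comm (b' k) (b i)]; ring
  simp_rw [h1]
  rw [Finset.sum_comm]
  refine Finset.sum_congr rfl fun j _ => ?_
  rw [Finset.sum_comm]
  simp_rw [← Finset.sum_mul, b.sum_inner_mul_inner, b'.inner_eq_ite]
  simp

theorem sum_norm_sq_map_eq {ι κ : Type*} [Fintype ι] [Fintype κ]
    (b : OrthonormalBasis ι ℝ V) (b' : OrthonormalBasis κ ℝ V) (S : V →ₗ[ℝ] W) :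
    ∑ i, ‖S (b i)‖ ^ 2 = ∑ j, ‖S (b' j)‖ ^ 2 := by
  simpa only [real_inner_self_eq_norm_sq] using sum_inner_map_eq b b' S S

theorem sum_norm_sq_comm_of_eigenbasis {A : V →ₗ[ℝ] V} (hA : A.IsSymmetric) (B : V →ₗ[ℝ] V)
    (b : OrthonormalBasis (Fin n) ℝ V) {η : Fin n → ℝ} (hb : ∀ p, A (b p) = η p • b p) :
    ∑ p, ‖(A ∘ₗ B - B ∘ₗ A) (b p)‖ ^ 2 =
      ∑ p, ∑ q, (η p - η q) ^ 2 * ⟪B (b p), b q⟫ ^ 2 := by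
  refine Finset.sum_congr rfl fun p _ => ?_
  rw [← b.sum_sq_norm_inner_right]
  refine Finset.sum_congr rfl fun q _ => ?_
  have : ⟪b q, (A ∘ₗ B - B ∘ₗ A) (b p)⟫ = (η q - η p) * ⟪B (b p), b q⟫ := by
    simp only [LinearMap.sub_apply, LinearMap.comp_apply, inner_sub_right, hb, map_smul,
      real_inner_smul_right]
    rw [← hA, hb, real_inner_smul_left, real_inner_comm]; ring
  rw [this, Real.norm_eq_abs, sq_abs]; ring

theorem sum_inner_map_eq_sum_entries (b : OrthonormalBasis (Fin n) ℝ V) (A B : V →ₗ[ℝ] V) :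
    ∑ p, ⟪A (b p), B (b p)⟫ = ∑ p, ∑ q, ⟪A (b p), b q⟫ * ⟪B (b p), b q⟫ := by
  refine Finset.sum_congr rfl fun p _ => ?_
  rw [← b.sum_inner_mul_inner]
  exact Finset.sum_congr rfl fun q _ => by rw [real_inner_comm (b q) (B (b p))]

theorem exists_eigenbasis (e : OrthonormalBasis (Fin n) ℝ V) {A : V →ₗ[ℝ] V}
    (hA : A.IsSymmetric) :
    ∃ (b : OrthonormalBasis (Fin n) ℝ V) (η : Fin n → ℝ), ∀ p, A (b p) = η p • b p := by
  have : FiniteDimensional ℝ V := e.toBasis.finiteDimensional_of_finite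
  have hn : Module.finrank ℝ V = n := by
    rw [Module.finrank_eq_card_basis e.toBasis, Fintype.card_fin]
  exact ⟨hA.eigenvectorBasis hn, hA.eigenvalues hn, fun p => by simp⟩

theorem sum_norm_sq_comm_sub_one_le {κ : Type*} {J : Finset κ}
    (e : OrthonormalBasis (Fin n) ℝ V) {A : V →ₗ[ℝ] V} {B : κ → V →ₗ[ℝ] V}
    (hA : A.IsSymmetric) (hA1 : ∑ i, ⟪A (e i), A (e i)⟫ = 1) (hB : ∀ j, (B j).IsSymmetric)
    (ho : ∀ j ∈ J, ∀ k ∈ J, ∑ i, ⟪B j (e i), B k (e i)⟫ = if j = k then 1 else 0) :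
    ∑ j ∈ J, (∑ i, ‖(A ∘ₗ B j - B j ∘ₗ A) (e i)‖ ^ 2 - 1) ≤ 1 ∧
      (∑ j ∈ J, (∑ i, ‖(A ∘ₗ B j - B j ∘ₗ A) (e i)‖ ^ 2 - 1) = 1 →
        ∃ (b : OrthonormalBasis (Fin n) ℝ V) (η : Fin n → ℝ), (∀ p, A (b p) = η p • b p) ∧
          ∃ p, ∀ j ∈ J, ∀ u v, ⟪B j (b u), b v⟫ ≠ 0 →
            1 ≤ (η u - η v) ^ 2 ∧ (u = p ∨ v = p)) := by
  obtain ⟨b, η, hb⟩ := exists_eigenbasis e hA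
  have hη : ∑ u, η u ^ 2 = 1 := by
    rw [← hA1, sum_inner_map_eq e b]
    refine Finset.sum_congr rfl fun p _ => ?_
    rw [hb, real_inner_smul_left, real_inner_smul_right, real_inner_self_eq_norm_sq,
      b.norm_eq_one]; ring
  have key := sum_weighted_sq_sub_one_le (J := J) (B := fun j u v => ⟪B j (b u), b v⟫) hη
    (fun j u v => by rw [hB j, real_inner_comm])
    (fun j hj k hk => by
      rw [← ho j hj k hk, sum_inner_map_eq e b, sum_inner_map_eq_sum_entries])
  simp only [sum_norm_sq_map_eq e b, sum_norm_sq_comm_of_eigenbasis hA _ b hb]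
  exact ⟨key.1, fun h => ⟨b, η, hb, key.2 h⟩⟩

/-- A symmetric operator of unit Hilbert–Schmidt norm whose matrix is supported on one row and
column, off the diagonal, satisfies `B³ = B / 2`. -/
theorem apply_apply_apply_eq_half_smul (b : OrthonormalBasis (Fin n) ℝ V) {B : V →ₗ[ℝ] V}
    (hB : B.IsSymmetric) (hB1 : ∑ i, ⟪B (b i), B (b i)⟫ = 1) {p : Fin n}
    (hp : ⟪B (b p), b p⟫ = 0) (h : ∀ u v, ⟪B (b u), b v⟫ ≠ 0 → u = p ∨ v = p) (x : V) :
    B (B (B x)) = (1 / 2 : ℝ) • B x := by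
  have h1 : ∀ u, u ≠ p → B (b u) = ⟪B (b p), b u⟫ • b p := by
    intro u hu
    refine InnerProductSpace.ext_inner_right_basis b.toBasis fun v => ?_
    rw [b.coe_toBasis, real_inner_smul_left, b.inner_eq_ite]
    split_ifs with hv
    · subst hv; rw [hB, real_inner_comm, mul_one]
    · rw [mul_zero]
      by_contra h'
      exact (h u v h').elim hu (fun h => hv h.symm)
  have h2 : ‖B (b p)‖ ^ 2 = 1 / 2 := by
    have e1 : ‖B (b p)‖ ^ 2 = ∑ u ∈ Finset.univ.erase p, ⟪B (b p), b u⟫ ^ 2 := by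
      rw [← b.sum_sq_norm_inner_left, ← Finset.add_sum_erase _ _ (Finset.mem_univ p), hp]
      simp
    have e2 : ∑ u ∈ Finset.univ.erase p, ⟪B (b u), B (b u)⟫ =
        ∑ u ∈ Finset.univ.erase p, ⟪B (b p), b u⟫ ^ 2 := by
      refine Finset.sum_congr rfl fun u hu => ?_
      rw [h1 u (Finset.ne_of_mem_erase hu), real_inner_smul_left, real_inner_smul_right,
        real_inner_self_eq_norm_sq, b.norm_eq_one]; ring
    rw [← Finset.add_sum_erase _ _ (Finset.mem_univ p), e2, ← e1,
      real_inner_self_eq_norm_sq] at hB1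
    linarith
  have h3 : B (B (b p)) = (1 / 2 : ℝ) • b p := by
    refine InnerProductSpace.ext_inner_right_basis b.toBasis fun v => ?_
    rw [b.coe_toBasis, real_inner_smul_left, b.inner_eq_ite, hB]
    split_ifs with hv
    · subst hv; rw [real_inner_self_eq_norm_sq, h2, mul_one]
    · rw [h1 v (Ne.symm hv), real_inner_smul_right, hp]; simp
  have : B ∘ₗ B ∘ₗ B = (1 / 2 : ℝ) • B := by
    refine b.toBasis.ext fun u => ?_
    simp only [b.coe_toBasis, LinearMap.comp_apply, LinearMap.smul_apply]
    by_cases hu : u = p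
    · rw [hu, h3, map_smul]
    · rw [h1 u hu, map_smul, map_smul, h3, smul_comm]
  exact LinearMap.congr_fun this x

/-- Equality in the DDVV inequality for an orthonormal family of symmetric operators with
positive weights. -/
theorem exists_pair_of_orthonormal {ι : Type*} [Fintype ι] [Nonempty ι]
    (e : OrthonormalBasis (Fin n) ℝ V) {U : ι → V →ₗ[ℝ] V} (hU : ∀ i, (U i).IsSymmetric)
    (ho : ∀ j k, ∑ i, ⟪U j (e i), U k (e i)⟫ = if j = k then 1 else 0)
    {a : ι → ℝ} (ha : ∀ i, 0 < a i)
    (h : (∑ i, a i) ^ 2 =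
      ∑ i, ∑ j, (∑ k, ‖(U i ∘ₗ U j - U j ∘ₗ U i) (e k)‖ ^ 2) * (a i * a j)) :
    ∃ (i j : ι) (b : OrthonormalBasis (Fin n) ℝ V) (p q : Fin n) (s : ℝ),
      i ≠ j ∧ (∀ k, k = i ∨ k = j) ∧ a i = a j ∧ p ≠ q ∧
      U i (b p) = s • b p ∧ U i (b q) = -s • b q ∧ (∀ u, u ≠ p → u ≠ q → U i (b u) = 0) ∧
      U j (b p) = s • b q ∧ U j (b q) = s • b p ∧ (∀ u, u ≠ p → u ≠ q → U j (b u) = 0) := by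
  set c : ι → ι → ℝ := fun i j => ∑ k, ‖(U i ∘ₗ U j - U j ∘ₗ U i) (e k)‖ ^ 2 with hcdef
  have row : ∀ (i : ι) (J : Finset ι), _ := fun i J =>
    sum_norm_sq_comm_sub_one_le (J := J) e (hU i) (by rw [ho, if_pos rfl]) hU
      (fun j _ k _ => ho j k)
  obtain ⟨hrow, haeq⟩ := eq_of_sq_sum_eq_sum_mul (c := c) ha
    (fun i j => Finset.sum_congr rfl fun k _ => by
      rw [← norm_neg, ← LinearMap.neg_apply, neg_sub])
    (fun i => by simp [hcdef]) (fun i J _ => (row i J).1) h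
  have hstar := fun i => (row i (Finset.univ.erase i)).2 (hrow i)
  have hnorm : ∀ (b : OrthonormalBasis (Fin n) ℝ V) (j), ∑ u, ⟪U j (b u), U j (b u)⟫ = 1 :=
    fun b j => by rw [sum_inner_map_eq b e, ho, if_pos rfl]
  have hgt : ∀ i, ∃ j, j ≠ i ∧ 1 < c i j := by
    intro i
    by_contra! hcon
    have := hrow i
    have h0 : ∑ j ∈ Finset.univ.erase i, (c i j - 1) ≤ 0 :=
      Finset.sum_nonpos fun j hj => by linarith [hcon j (Finset.ne_of_mem_erase hj)]
    linarith
  have hcube : ∀ j x, U j (U j (U j x)) = (1 / 2 : ℝ) • U j x := by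
    intro j x
    obtain ⟨i, hij, -⟩ := hgt j
    obtain ⟨b, η, -, p, hp⟩ := hstar i
    have hj : j ∈ Finset.univ.erase i := by simp [hij.symm]
    refine apply_apply_apply_eq_half_smul b (hU j) (hnorm b j) (p := p) ?_
      (fun u v huv => (hp j hj u v huv).2) x
    by_contra h'
    have := (hp j hj p p h').1
    norm_num at this
  obtain ⟨i⟩ := ‹Nonempty ι›
  obtain ⟨j, hji, hcij⟩ := hgt i
  obtain ⟨b, η, hb, _, hsupp⟩ := hstar i
  have hηc : ∀ u, η u = 0 ∨ η u ^ 2 = 1 / 2 := by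
    intro u
    have h1 := hcube i (b u)
    simp only [hb, map_smul, smul_smul] at h1
    have h2 := smul_left_injective ℝ (b.orthonormal.ne_zero u) h1
    by_cases h0 : η u = 0
    · exact Or.inl h0
    · exact Or.inr (mul_left_cancel₀ h0 (by linarith))
  have hη : ∑ u, η u ^ 2 = 1 := by
    rw [← hnorm b i]
    refine Finset.sum_congr rfl fun u _ => ?_
    rw [hb, real_inner_smul_left, real_inner_smul_right, real_inner_self_eq_norm_sq,
      b.norm_eq_one]; ring
  -- a nonzero entry joins opposite eigenvalues
  have hopp : ∀ k, k ≠ i → ∀ u v, ⟪U k (b u), b v⟫ ≠ 0 → η u ^ 2 = 1 / 2 ∧ η v = - η u := by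
    intro k hk u v huv
    have h1 := (hsupp k (by simp [hk]) u v huv).1
    rcases hηc u with hu | hu <;> rcases hηc v with hv | hv
    · rw [hu, hv] at h1; norm_num at h1
    · rw [hu] at h1; nlinarith
    · rw [hv] at h1; nlinarith
    · refine ⟨hu, ?_⟩
      have h2 : (η v - η u) * (η v + η u) = 0 := by nlinarith
      rcases mul_eq_zero.1 h2 with h3 | h3
      · nlinarith
      · linarith
  obtain ⟨p, q, hpq⟩ : ∃ p q, ⟪U j (b p), b q⟫ ≠ 0 := by
    by_contra! h0
    have := hnorm b j
    rw [sum_inner_map_eq_sum_entries] at this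
    simp [h0] at this
  obtain ⟨hp2, hqp⟩ := hopp j hji p q hpq
  have hne : p ≠ q := by rintro rfl; nlinarith
  have hz : ∀ u, u ≠ p → u ≠ q → η u = 0 := by
    intro u hup huq
    have : ∑ v ∈ {p, q, u}, η v ^ 2 ≤ ∑ v, η v ^ 2 :=
      Finset.sum_le_sum_of_subset_of_nonneg (Finset.subset_univ _) fun _ _ _ => sq_nonneg _
    rw [Finset.sum_insert (by simp [hne, hup.symm]), Finset.sum_pair huq.symm, hη, hp2, hqp,
      neg_sq, hp2] at this
    exact pow_eq_zero_iff two_ne_zero |>.1 (le_antisymm (by linarith) (sq_nonneg _))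
  have hent : ∀ k, k ≠ i → ∀ u v, ⟪U k (b u), b v⟫ ≠ 0 → (u = p ∧ v = q) ∨ (u = q ∧ v = p) := by
    intro k hk u v huv
    obtain ⟨hu, hv⟩ := hopp k hk u v huv
    have hu' : u = p ∨ u = q := by
      by_contra! h0
      rw [hz u h0.1 h0.2] at hu; norm_num at hu
    have hv' : v = p ∨ v = q := by
      by_contra! h0
      have := hz v h0.1 h0.2
      nlinarith
    rcases hu' with rfl | rfl <;> rcases hv' with rfl | rfl
    · nlinarith
    · exact Or.inl ⟨rfl, rfl⟩
    · exact Or.inr ⟨rfl, rfl⟩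
    · nlinarith
  set t : ι → ℝ := fun k => ⟪U k (b p), b q⟫ with ht
  have hUp : ∀ k, k ≠ i → U k (b p) = t k • b q := by
    intro k hk
    refine InnerProductSpace.ext_inner_right_basis b.toBasis fun v => ?_
    rw [b.coe_toBasis, real_inner_smul_left, b.inner_eq_ite]
    split_ifs with hv
    · rw [mul_one, ← hv]
    · by_contra h0
      rw [mul_zero] at h0
      rcases hent k hk p v h0 with h1 | h1
      · exact hv h1.2.symm
      · exact hne h1.1
  have hUq : ∀ k, k ≠ i → U k (b q) = t k • b p := by
    intro k hk
    refine InnerProductSpace.ext_inner_right_basis b.toBasis fun v => ?_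
    rw [b.coe_toBasis, real_inner_smul_left, b.inner_eq_ite]
    split_ifs with hv
    · rw [mul_one, ← hv, hU k, real_inner_comm]
    · by_contra h0
      rw [mul_zero] at h0
      rcases hent k hk q v h0 with h1 | h1
      · exact hne h1.1.symm
      · exact hv h1.2.symm
  have hUz : ∀ k, k ≠ i → ∀ u, u ≠ p → u ≠ q → U k (b u) = 0 := by
    intro k hk u hup huq
    refine InnerProductSpace.ext_inner_right_basis b.toBasis fun v => ?_
    rw [inner_zero_left, b.coe_toBasis]
    by_contra h0
    rcases hent k hk u v h0 with h1 | h1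
    · exact hup h1.1
    · exact huq h1.1
  have hinner : ∀ k l, k ≠ i → l ≠ i → ∑ u, ⟪U k (b u), U l (b u)⟫ = 2 * (t k * t l) := by
    intro k l hk hl
    rw [← Finset.sum_subset (Finset.subset_univ {p, q}) (fun u _ hu => by
      simp only [Finset.mem_insert, Finset.mem_singleton, not_or] at hu
      rw [hUz k hk u hu.1 hu.2, inner_zero_left]), Finset.sum_pair hne, hUp k hk, hUp l hl,
      hUq k hk, hUq l hl]
    simp only [real_inner_smul_left, real_inner_smul_right, real_inner_self_eq_norm_sq,
      b.norm_eq_one]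
    ring
  have htj : t j ^ 2 = 1 / 2 := by
    have := hnorm b j
    rw [hinner j j hji hji] at this
    linarith
  have hall : ∀ k, k = i ∨ k = j := by
    intro k
    by_contra! hk
    have h1 : ∑ u, ⟪U j (b u), U k (b u)⟫ = 0 := by
      rw [sum_inner_map_eq b e, ho, if_neg hk.2.symm]
    have h2 := hnorm b k
    rw [hinner j k hji hk.1] at h1
    rw [hinner k k hk.1 hk.1] at h2
    have : t j * t k = 0 := by linarith
    rcases mul_eq_zero.1 this with h3 | h3
    · rw [h3] at htj; norm_num at htj
    · rw [h3] at h2; norm_num at h2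
  have hUi : ∀ u, u ≠ p → u ≠ q → U i (b u) = 0 := fun u hup huq => by
    rw [hb, hz u hup huq, zero_smul]
  have hsign : (η p - t j) * (η p + t j) = 0 := by nlinarith
  rcases mul_eq_zero.1 hsign with hs | hs
  · have hs' : t j = η p := by linarith
    exact ⟨i, j, b, p, q, η p, hji.symm, hall, haeq i j hcij, hne, hb p, by rw [hb, hqp], hUi,
      by rw [hUp j hji, hs'], by rw [hUq j hji, hs'], hUz j hji⟩
  · have hs' : t j = η q := by linarith
    exact ⟨i, j, b, q, p, η q, hji.symm, hall, haeq i j hcij, hne.symm, hb q,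
      by rw [hb, hqp, neg_neg], fun u h1 h2 => hUi u h2 h1,
      by rw [hUq j hji, hs'], by rw [hUp j hji, hs'], fun u h1 h2 => hUz j hji u h2 h1⟩

/-- Equality in the DDVV inequality for a Hilbert–Schmidt orthogonal family of symmetric
operators. -/
theorem eq_zero_or_exists_pair {ι : Type*} [Fintype ι] (e : OrthonormalBasis (Fin n) ℝ V)
    {C : ι → V →ₗ[ℝ] V} (hC : ∀ a, (C a).IsSymmetric)
    (ho : ∀ a b, a ≠ b → ∑ i, ⟪C a (e i), C b (e i)⟫ = 0)
    (h : (∑ a, ∑ i, ‖C a (e i)‖ ^ 2) ^ 2 =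
      ∑ a, ∑ b, ∑ i, ‖(C a ∘ₗ C b - C b ∘ₗ C a) (e i)‖ ^ 2) :
    (∀ a, C a = 0) ∨
    ∃ (a b : ι) (f : OrthonormalBasis (Fin n) ℝ V) (p q : Fin n) (μ : ℝ),
      a ≠ b ∧ (∀ c, c ≠ a → c ≠ b → C c = 0) ∧ p ≠ q ∧
      C a (f p) = μ • f p ∧ C a (f q) = -μ • f q ∧ (∀ u, u ≠ p → u ≠ q → C a (f u) = 0) ∧
      C b (f p) = μ • f q ∧ C b (f q) = μ • f p ∧ (∀ u, u ≠ p → u ≠ q → C b (f u) = 0) := by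
  by_cases h0 : ∀ a, C a = 0
  · exact Or.inl h0
  right
  push Not at h0
  obtain ⟨a₀, ha₀⟩ := h0
  have : Nonempty {a // C a ≠ 0} := ⟨⟨a₀, ha₀⟩⟩
  set N : {a // C a ≠ 0} → ℝ := fun a => ∑ i, ‖C a (e i)‖ ^ 2 with hN
  have hNpos : ∀ a, 0 < N a := by
    intro a
    refine lt_of_le_of_ne (Finset.sum_nonneg fun _ _ => sq_nonneg _) fun h0 => a.2 ?_
    refine e.toBasis.ext fun i => ?_
    have := (Finset.sum_eq_zero_iff_of_nonneg fun i _ => sq_nonneg ‖C a (e i)‖).1 h0.symm i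
      (Finset.mem_univ _)
    simpa using this
  set r : {a // C a ≠ 0} → ℝ := fun a => √(N a) with hr
  have hrpos : ∀ a, 0 < r a := fun a => Real.sqrt_pos.2 (hNpos a)
  have hrsq : ∀ a, r a ^ 2 = N a := fun a => Real.sq_sqrt (hNpos a).le
  set U : {a // C a ≠ 0} → V →ₗ[ℝ] V := fun a => (r a)⁻¹ • C a with hU
  have hCU : ∀ a : {a // C a ≠ 0}, C a = r a • U a := fun a => by
    simp only [hU]; rw [smul_inv_smul₀ (hrpos a).ne']
  have drop : ∀ g : ι → ℝ, (∀ a, C a = 0 → g a = 0) →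
      ∑ a, g a = ∑ a : {a // C a ≠ 0}, g a := by
    intro g hg
    rw [← Fintype.sum_subtype_add_sum_subtype (fun a => C a ≠ 0) g, add_eq_left]
    exact Finset.sum_eq_zero fun a _ => hg a (not_not.1 a.2)
  obtain ⟨i, j, f, p, q, s, hij, hall, haij, hpq, h1, h2, h3, h4, h5, h6⟩ :=
    exists_pair_of_orthonormal e (U := U) (a := N)
      (fun a x y => by
        simp only [hU, LinearMap.smul_apply, real_inner_smul_left, real_inner_smul_right,
          hC (a : ι) x y])
      (fun a b => by
        simp only [hU, LinearMap.smul_apply, real_inner_smul_left, real_inner_smul_right,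
          ← Finset.mul_sum]
        split_ifs with hab
        · subst hab
          simp only [real_inner_self_eq_norm_sq]
          change _ * (_ * N a) = 1
          rw [← hrsq a]
          field_simp [(hrpos a).ne']
        · rw [ho a b fun h => hab (Subtype.ext h)]; simp)
      hNpos (by
        rw [drop _ (fun a ha => by simp [ha]), drop _ (fun a ha => by simp [ha])] at h
        rw [h]
        refine Finset.sum_congr rfl fun a _ => ?_
        rw [drop _ (fun a ha => by simp [ha])]
        refine Finset.sum_congr rfl fun b _ => ?_
        rw [Finset.sum_mul]
        refine Finset.sum_congr rfl fun k _ => ?_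
        have : C a ∘ₗ C b - C b ∘ₗ C a = (r a * r b) • (U a ∘ₗ U b - U b ∘ₗ U a) := by
          rw [hCU a, hCU b]
          simp only [LinearMap.comp_smul, LinearMap.smul_comp, smul_smul, smul_sub, mul_comm]
        rw [this, LinearMap.smul_apply, norm_smul, mul_pow, Real.norm_eq_abs, sq_abs, mul_pow,
          hrsq, hrsq, mul_comm])
  have hrij : r j = r i := by simp only [hr, haij]
  refine ⟨i, j, f, p, q, r i * s, fun h => hij (Subtype.ext h), fun c hci hcj => ?_, hpq, ?_, ?_,
    ?_, ?_, ?_, ?_⟩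
  · by_contra hc
    rcases hall ⟨c, hc⟩ with h | h
    · exact hci (congrArg Subtype.val h)
    · exact hcj (congrArg Subtype.val h)
  · rw [hCU, LinearMap.smul_apply, h1, smul_smul]
  · rw [hCU, LinearMap.smul_apply, h2, smul_smul, mul_neg]
  · intro u hu hu'; rw [hCU, LinearMap.smul_apply, h3 u hu hu', smul_zero]
  · rw [hCU, LinearMap.smul_apply, h4, smul_smul, hrij]
  · rw [hCU, LinearMap.smul_apply, h5, smul_smul, hrij]
  · intro u hu hu'; rw [hCU, LinearMap.smul_apply, h6 u hu hu', smul_zero]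

theorem sums_of_pair {ι : Type*} [Fintype ι] {C : ι → V →ₗ[ℝ] V} {a b : ι}
    {f : OrthonormalBasis (Fin n) ℝ V} {p q : Fin n} {μ : ℝ} (hab : a ≠ b)
    (h0 : ∀ c, c ≠ a → c ≠ b → C c = 0) (hpq : p ≠ q)
    (h1 : C a (f p) = μ • f p) (h2 : C a (f q) = -μ • f q)
    (h3 : ∀ u, u ≠ p → u ≠ q → C a (f u) = 0)
    (h4 : C b (f p) = μ • f q) (h5 : C b (f q) = μ • f p)
    (h6 : ∀ u, u ≠ p → u ≠ q → C b (f u) = 0) :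
    ∑ c, ∑ i, ‖C c (f i)‖ ^ 2 = 4 * μ ^ 2 ∧
      ∑ c, ∑ d, ∑ i, ‖(C c ∘ₗ C d - C d ∘ₗ C c) (f i)‖ ^ 2 = (4 * μ ^ 2) ^ 2 := by
  constructor
  · rw [Fintype.sum_eq_add a b hab (fun c hc => by simp [h0 c hc.1 hc.2]),
      Fintype.sum_eq_add p q hpq (fun u hu => by simp [h3 u hu.1 hu.2]),
      Fintype.sum_eq_add p q hpq (fun u hu => by simp [h6 u hu.1 hu.2]), h1, h2, h4, h5]
    simp only [norm_smul, f.norm_eq_one, Real.norm_eq_abs, mul_one, abs_neg, sq_abs]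
    ring
  · have key : ∑ i, ‖(C a ∘ₗ C b - C b ∘ₗ C a) (f i)‖ ^ 2 = 8 * μ ^ 4 := by
      rw [Fintype.sum_eq_add p q hpq (fun u hu => by simp [h3 u hu.1 hu.2, h6 u hu.1 hu.2])]
      have e1 : (C a ∘ₗ C b - C b ∘ₗ C a) (f p) = (-2 * μ ^ 2) • f q := by
        simp only [LinearMap.sub_apply, LinearMap.comp_apply, h1, h4, map_smul, h2]
        module
      have e2 : (C a ∘ₗ C b - C b ∘ₗ C a) (f q) = (2 * μ ^ 2) • f p := by
        simp only [LinearMap.sub_apply, LinearMap.comp_apply, h1, h5, map_smul, h2]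
        module
      rw [e1, e2]
      simp only [norm_smul, f.norm_eq_one, Real.norm_eq_abs, mul_one, sq_abs]
      ring
    have key' : ∑ i, ‖(C b ∘ₗ C a - C a ∘ₗ C b) (f i)‖ ^ 2 = 8 * μ ^ 4 := by
      rw [← key]
      exact Finset.sum_congr rfl fun i _ => by rw [← norm_neg, ← LinearMap.neg_apply, neg_sub]
    rw [Fintype.sum_eq_add a b hab (fun c hc => by simp [h0 c hc.1 hc.2]),
      Fintype.sum_eq_add a b hab (fun c hc => by simp [h0 c hc.1 hc.2]),
      Fintype.sum_eq_add a b hab (fun c hc => by simp [h0 c hc.1 hc.2]), key, key']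
    simp only [sub_self, LinearMap.zero_apply, norm_zero]
    simp
    ring

theorem exists_orthogonalizing_basis (e : OrthonormalBasis (Fin n) ℝ V)
    (ξ : OrthonormalBasis (Fin m) ℝ W) (C : W →ₗ[ℝ] V →ₗ[ℝ] V) :
    ∃ ξ' : OrthonormalBasis (Fin m) ℝ W,
      ∀ a b, a ≠ b → ∑ i, ⟪C (ξ' a) (e i), C (ξ' b) (e i)⟫ = 0 := by
  have : FiniteDimensional ℝ V := e.toBasis.finiteDimensional_of_finite
  have : FiniteDimensional ℝ W := ξ.toBasis.finiteDimensional_of_finite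
  set G : W →ₗ[ℝ] W := ∑ i, (C.flip (e i)).adjoint ∘ₗ C.flip (e i) with hG
  have hGi : ∀ x y, ⟪G x, y⟫ = ∑ i, ⟪C x (e i), C y (e i)⟫ := fun x y => by
    simp [hG, LinearMap.sum_apply, sum_inner, LinearMap.adjoint_inner_left]
  have hGs : G.IsSymmetric := fun x y => by
    rw [real_inner_comm (G y) x, hGi, hGi]
    exact Finset.sum_congr rfl fun i _ => real_inner_comm _ _
  obtain ⟨ξ', η, hη⟩ := exists_eigenbasis ξ hGs
  refine ⟨ξ', fun a b hab => ?_⟩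
  rw [← hGi, hη, real_inner_smul_left, ξ'.inner_eq_zero hab, mul_zero]

theorem inner_shapeOp (e : OrthonormalBasis (Fin n) ℝ V) (ξ : OrthonormalBasis (Fin m) ℝ W)
    (β : V →ₗ[ℝ] V →ₗ[ℝ] W) (z : W) (x y : V) : ⟪shapeOp β z x, y⟫ = ⟪β x y, z⟫ := by
  have : FiniteDimensional ℝ V := e.toBasis.finiteDimensional_of_finite
  have : FiniteDimensional ℝ W := ξ.toBasis.finiteDimensional_of_finite
  have h : ∃ A : V →ₗ[ℝ] V, ∀ x y : V, ⟪β x y, z⟫ = ⟪A x, y⟫ :=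
    ⟨{ toFun := fun x => (β x).adjoint z
       map_add' := fun x y => by simp
       map_smul' := fun r x => by simp },
      fun x y => by simp [LinearMap.adjoint_inner_left, real_inner_comm]⟩
  rw [shapeOp, dif_pos h]
  exact (h.choose_spec x y).symm

/-- The traceless part of the shape operator, as a linear function of the normal vector. -/
theorem exists_traceless_shapeOp (hn : n ≠ 0) (e : OrthonormalBasis (Fin n) ℝ V)
    (ξ : OrthonormalBasis (Fin m) ℝ W) {β : V →ₗ[ℝ] V →ₗ[ℝ] W} (hβ : IsSymmBil β) :
    ∃ C : W →ₗ[ℝ] V →ₗ[ℝ] V,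
      (∀ z, shapeOp β z = C z + ⟪meanCurv e β, z⟫ • LinearMap.id) ∧
      (∀ z, (C z).IsSymmetric) ∧ ∀ z, ∑ i, ⟪C z (e i), e i⟫ = 0 := by
  have hS := inner_shapeOp e ξ β
  let S : W →ₗ[ℝ] V →ₗ[ℝ] V :=
    { toFun := shapeOp β
      map_add' := fun z w => LinearMap.ext fun x => ext_inner_right ℝ fun y => by
        simp only [LinearMap.add_apply, inner_add_left, hS, inner_add_right]
      map_smul' := fun r z => LinearMap.ext fun x => ext_inner_right ℝ fun y => by
        simp only [LinearMap.smul_apply, real_inner_smul_left, hS, real_inner_smul_right,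
          RingHom.id_apply] }
  have hC : ∀ z, (S - (innerₗ W (meanCurv e β)).smulRight LinearMap.id : W →ₗ[ℝ] V →ₗ[ℝ] V) z =
      shapeOp β z - ⟪meanCurv e β, z⟫ • LinearMap.id := fun z => rfl
  refine ⟨S - (innerₗ W (meanCurv e β)).smulRight LinearMap.id, fun z => ?_, fun z x y => ?_,
    fun z => ?_⟩
  · rw [hC]; abel
  · simp only [hC, LinearMap.sub_apply, LinearMap.smul_apply, LinearMap.id_apply, inner_sub_left,
      inner_sub_right, hS, real_inner_smul_left, real_inner_smul_right]
    rw [real_inner_comm (shapeOp β z y) x, hS, hβ x y]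
  · have hn' : (n : ℝ) ≠ 0 := Nat.cast_ne_zero.2 hn
    have hH : ∑ i, β (e i) (e i) = (n : ℝ) • meanCurv e β := by
      rw [meanCurv, smul_inv_smul₀ hn']
    simp only [hC, LinearMap.sub_apply, LinearMap.smul_apply, LinearMap.id_apply, inner_sub_left,
      hS, real_inner_smul_left, real_inner_self_eq_norm_sq, e.norm_eq_one,
      Finset.sum_sub_distrib]
    rw [← sum_inner, hH, real_inner_smul_left]
    simp

theorem sum_sum_norm_sq_eq (e e' : OrthonormalBasis (Fin n) ℝ V)
    (ξ ξ' : OrthonormalBasis (Fin m) ℝ W) (C : W →ₗ[ℝ] V →ₗ[ℝ] V) :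
    ∑ a, ∑ i, ‖C (ξ a) (e i)‖ ^ 2 = ∑ a, ∑ i, ‖C (ξ' a) (e' i)‖ ^ 2 := by
  rw [Finset.sum_congr rfl fun a _ => sum_norm_sq_map_eq e e' (C (ξ a)), Finset.sum_comm,
    Finset.sum_comm (f := fun a i => ‖C (ξ' a) (e' i)‖ ^ 2)]
  exact Finset.sum_congr rfl fun i _ => sum_norm_sq_map_eq ξ ξ' (C.flip (e' i))

theorem sum_sum_norm_sq_comm_eq (e e' : OrthonormalBasis (Fin n) ℝ V)
    (ξ ξ' : OrthonormalBasis (Fin m) ℝ W) (C : W →ₗ[ℝ] V →ₗ[ℝ] V) :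
    ∑ a, ∑ b, ∑ i, ‖(C (ξ a) ∘ₗ C (ξ b) - C (ξ b) ∘ₗ C (ξ a)) (e i)‖ ^ 2 =
      ∑ a, ∑ b, ∑ i, ‖(C (ξ' a) ∘ₗ C (ξ' b) - C (ξ' b) ∘ₗ C (ξ' a)) (e' i)‖ ^ 2 := by
  let K : W →ₗ[ℝ] W →ₗ[ℝ] V →ₗ[ℝ] V := LinearMap.mk₂ ℝ (fun z w => C z ∘ₗ C w - C w ∘ₗ C z)
    (fun x y z => by simp only [map_add, LinearMap.add_comp, LinearMap.comp_add]; abel)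
    (fun r x z => by
      simp only [map_smul, LinearMap.smul_comp, LinearMap.comp_smul, smul_sub])
    (fun x y z => by simp only [map_add, LinearMap.add_comp, LinearMap.comp_add]; abel)
    (fun r x z => by
      simp only [map_smul, LinearMap.smul_comp, LinearMap.comp_smul, smul_sub])
  change ∑ a, ∑ b, ∑ i, ‖K (ξ a) (ξ b) (e i)‖ ^ 2 = ∑ a, ∑ b, ∑ i, ‖K (ξ' a) (ξ' b) (e' i)‖ ^ 2
  rw [Finset.sum_congr rfl fun a _ => sum_sum_norm_sq_eq e e' ξ ξ' (K (ξ a)), Finset.sum_comm,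
    Finset.sum_comm (f := fun a b => ∑ i, ‖K (ξ' a) (ξ' b) (e' i)‖ ^ 2)]
  exact Finset.sum_congr rfl fun b _ => sum_sum_norm_sq_eq e' e' ξ ξ' (K.flip (ξ' b))

theorem rho_eq_iff (hn : 2 ≤ n) {e : OrthonormalBasis (Fin n) ℝ V}
    {ξ : OrthonormalBasis (Fin m) ℝ W} {β : V →ₗ[ℝ] V →ₗ[ℝ] W} {C : W →ₗ[ℝ] V →ₗ[ℝ] V}
    (hC : ∀ z, shapeOp β z = C z + ⟪meanCurv e β, z⟫ • LinearMap.id)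
    (hC₀ : ∀ z, ∑ i, ⟪C z (e i), e i⟫ = 0) (c : ℝ)
    (e' : OrthonormalBasis (Fin n) ℝ V) (ξ' : OrthonormalBasis (Fin m) ℝ W) :
    rho c e β = c + ‖meanCurv e β‖ ^ 2 - rhoPerp e ξ β ↔
      (∑ a, ∑ i, ‖C (ξ' a) (e' i)‖ ^ 2) ^ 2 =
        ∑ a, ∑ b, ∑ i, ‖(C (ξ' a) ∘ₗ C (ξ' b) - C (ξ' b) ∘ₗ C (ξ' a)) (e' i)‖ ^ 2 := by
  have hn' : (2 : ℝ) ≤ n := by exact_mod_cast hn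
  have hcomm : ∀ z w, shapeOp β z ∘ₗ shapeOp β w - shapeOp β w ∘ₗ shapeOp β z =
      C z ∘ₗ C w - C w ∘ₗ C z := by
    intro z w
    ext x
    simp only [hC, LinearMap.sub_apply, LinearMap.comp_apply, LinearMap.add_apply,
      LinearMap.smul_apply, LinearMap.id_apply, map_add, map_smul]
    module
  have hshape : ∑ a, ∑ i, ‖shapeOp β (ξ a) (e i)‖ ^ 2 =
      ∑ a, ∑ i, ‖C (ξ a) (e i)‖ ^ 2 + n * ‖meanCurv e β‖ ^ 2 := by
    rw [← ξ.sum_sq_norm_inner_left, Finset.mul_sum, ← Finset.sum_add_distrib]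
    refine Finset.sum_congr rfl fun a _ => ?_
    have : ∀ i, ‖shapeOp β (ξ a) (e i)‖ ^ 2 = ‖C (ξ a) (e i)‖ ^ 2 +
        2 * ⟪meanCurv e β, ξ a⟫ * ⟪C (ξ a) (e i), e i⟫ + ⟪meanCurv e β, ξ a⟫ ^ 2 := by
      intro i
      rw [hC, LinearMap.add_apply, LinearMap.smul_apply, LinearMap.id_apply, norm_add_sq_real,
        real_inner_smul_right, norm_smul, e.norm_eq_one, mul_one, Real.norm_eq_abs, sq_abs]
      ring
    simp_rw [this, Finset.sum_add_distrib, ← Finset.mul_sum, hC₀]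
    simp
  have hnorm : ∑ i, ∑ j, ⟪β (e i) (e j), β (e i) (e j)⟫ =
      ∑ a, ∑ i, ‖shapeOp β (ξ a) (e i)‖ ^ 2 := by
    rw [Finset.sum_comm (f := fun a i => ‖shapeOp β (ξ a) (e i)‖ ^ 2)]
    refine Finset.sum_congr rfl fun i _ => ?_
    rw [Finset.sum_congr rfl fun a _ => (e.sum_sq_norm_inner_left (shapeOp β (ξ a) (e i))).symm,
      Finset.sum_comm]
    refine Finset.sum_congr rfl fun j _ => ?_
    rw [real_inner_self_eq_norm_sq, ← ξ.sum_sq_norm_inner_left]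
    exact Finset.sum_congr rfl fun a _ => by rw [inner_shapeOp e ξ]
  have hric : ∑ i, ric c e β (e i) (e i) = c * (n - 1) * n + n ^ 2 * ‖meanCurv e β‖ ^ 2 -
      ∑ a, ∑ i, ‖shapeOp β (ξ a) (e i)‖ ^ 2 := by
    have hH : ∑ i, β (e i) (e i) = (n : ℝ) • meanCurv e β := by
      rw [meanCurv, smul_inv_smul₀ (by linarith)]
    simp_rw [ric, Finset.sum_sub_distrib, Finset.sum_add_distrib, hnorm, ← Finset.mul_sum,
      ← inner_sum, hH, real_inner_smul_right, real_inner_self_eq_norm_sq, e.norm_eq_one]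
    simp
    ring
  have hpos : (0 : ℝ) < n * (n - 1) := mul_pos (by linarith) (by linarith)
  rw [← sum_sum_norm_sq_eq e e' ξ ξ' C, ← sum_sum_norm_sq_comm_eq e e' ξ ξ' C, rho, hric, hshape,
    rhoPerp]
  simp_rw [hcomm]
  set X := ∑ a, ∑ i, ‖C (ξ a) (e i)‖ ^ 2 with hX
  set Y := ∑ a, ∑ b, ∑ i, ‖(C (ξ a) ∘ₗ C (ξ b) - C (ξ b) ∘ₗ C (ξ a)) (e i)‖ ^ 2 with hY
  have hX0 : 0 ≤ X := Finset.sum_nonneg fun _ _ => Finset.sum_nonneg fun _ _ => sq_nonneg _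
  have hY0 : 0 ≤ Y := Finset.sum_nonneg fun _ _ => Finset.sum_nonneg fun _ _ =>
    Finset.sum_nonneg fun _ _ => sq_nonneg _
  rw [show (n * (n - 1) : ℝ)⁻¹ * (c * (n - 1) * n + n ^ 2 * ‖meanCurv e β‖ ^ 2 -
      (X + n * ‖meanCurv e β‖ ^ 2)) = c + ‖meanCurv e β‖ ^ 2 - (n * (n - 1) : ℝ)⁻¹ * X by
    have h1 : (n : ℝ) ≠ 0 := by linarith
    have h2 : (n : ℝ) - 1 ≠ 0 := by linarith
    field_simp
    ring]
  rw [sub_right_inj, mul_right_inj' (inv_ne_zero hpos.ne'), eq_comm,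
    Real.sqrt_eq_iff_eq_sq hY0 hX0, eq_comm]

theorem exists_perm_apply_eq {α : Type*} {a b c d : α} (hab : a ≠ b) (hcd : c ≠ d) :
    ∃ σ : Equiv.Perm α, σ a = c ∧ σ b = d := by
  refine ⟨(Equiv.swap a c).trans (Equiv.swap (Equiv.swap a c b) d), ?_, by simp⟩
  have h : c ≠ Equiv.swap a c b := fun h => hab <| by
    rw [← Equiv.swap_apply_left a c] at h
    exact (Equiv.swap a c).injective (by simpa using h)
  simp [Equiv.swap_apply_of_ne_of_ne h hcd]

/-- the equality case of the algebraic DDVV inequality. -/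
theorem stmt2 (n m : ℕ) (hn : 2 ≤ n) (hm : 2 ≤ m)
    {V W : Type*} [NormedAddCommGroup V] [InnerProductSpace ℝ V]
    [NormedAddCommGroup W] [InnerProductSpace ℝ W]
    (e : OrthonormalBasis (Fin n) ℝ V) (ξ : OrthonormalBasis (Fin m) ℝ W)
    (β : V →ₗ[ℝ] V →ₗ[ℝ] W) (hβ : IsSymmBil β) (c : ℝ) :
    rho c e β = c + ‖meanCurv e β‖ ^ 2 - rhoPerp e ξ β ↔
      ∃ (e' : OrthonormalBasis (Fin n) ℝ V) (ξ' : OrthonormalBasis (Fin m) ℝ W)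
        (μ₀ : ℝ) (lam : Fin m → ℝ),
        shapeOp β (ξ' ⟨0, by omega⟩) (e' ⟨0, by omega⟩)
            = (lam ⟨0, by omega⟩ + μ₀) • e' ⟨0, by omega⟩ ∧
        shapeOp β (ξ' ⟨0, by omega⟩) (e' ⟨1, by omega⟩)
            = (lam ⟨0, by omega⟩ - μ₀) • e' ⟨1, by omega⟩ ∧
        (∀ i : Fin n, 2 ≤ (i : ℕ) →
          shapeOp β (ξ' ⟨0, by omega⟩) (e' i) = lam ⟨0, by omega⟩ • e' i) ∧
        shapeOp β (ξ' ⟨1, by omega⟩) (e' ⟨0, by omega⟩)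
            = lam ⟨1, by omega⟩ • e' ⟨0, by omega⟩ + μ₀ • e' ⟨1, by omega⟩ ∧
        shapeOp β (ξ' ⟨1, by omega⟩) (e' ⟨1, by omega⟩)
            = μ₀ • e' ⟨0, by omega⟩ + lam ⟨1, by omega⟩ • e' ⟨1, by omega⟩ ∧
        (∀ i : Fin n, 2 ≤ (i : ℕ) →
          shapeOp β (ξ' ⟨1, by omega⟩) (e' i) = lam ⟨1, by omega⟩ • e' i) ∧
        (∀ a : Fin m, 2 ≤ (a : ℕ) →
          shapeOp β (ξ' a) = lam a • (LinearMap.id : V →ₗ[ℝ] V)) := by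
  obtain ⟨C, hC, hCs, hC₀⟩ := exists_traceless_shapeOp (by omega) e ξ hβ
  have hn01 : (⟨0, by omega⟩ : Fin n) ≠ ⟨1, by omega⟩ := by simp
  have hm01 : (⟨0, by omega⟩ : Fin m) ≠ ⟨1, by omega⟩ := by simp
  have two_le : ∀ {k : ℕ} (hk : 2 ≤ k) (i : Fin k), 2 ≤ (i : ℕ) ↔
      i ≠ ⟨0, by omega⟩ ∧ i ≠ ⟨1, by omega⟩ := by
    intro k hk i
    simp only [ne_eq, Fin.ext_iff]
    omega
  constructor
  · intro h
    obtain ⟨ξ₁, hξ₁⟩ := exists_orthogonalizing_basis e ξ C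
    rw [rho_eq_iff hn hC hC₀ c e ξ₁] at h
    rcases eq_zero_or_exists_pair e (fun a => hCs (ξ₁ a)) hξ₁ h with h0 |
      ⟨a, b, f, p, q, μ, hab, h0, hpq, h1, h2, h3, h4, h5, h6⟩
    · refine ⟨e, ξ₁, 0, fun a => ⟪meanCurv e β, ξ₁ a⟫, ?_⟩
      simp [hC, h0]
    · obtain ⟨σ, hσ0, hσ1⟩ := exists_perm_apply_eq hpq hn01
      obtain ⟨τ, hτ0, hτ1⟩ := exists_perm_apply_eq hab hm01
      have hf0 : f.reindex σ ⟨0, by omega⟩ = f p := by rw [← hσ0]; simp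
      have hf1 : f.reindex σ ⟨1, by omega⟩ = f q := by rw [← hσ1]; simp
      have hx0 : ξ₁.reindex τ ⟨0, by omega⟩ = ξ₁ a := by rw [← hτ0]; simp
      have hx1 : ξ₁.reindex τ ⟨1, by omega⟩ = ξ₁ b := by rw [← hτ1]; simp
      have hσ : ∀ i : Fin n, 2 ≤ (i : ℕ) → σ.symm i ≠ p ∧ σ.symm i ≠ q := fun i hi => by
        rw [two_le hn, ← hσ0, ← hσ1] at hi
        simpa only [ne_eq, Equiv.symm_apply_eq] using hi
      have hτ : ∀ i : Fin m, 2 ≤ (i : ℕ) → τ.symm i ≠ a ∧ τ.symm i ≠ b := fun i hi => by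
        rw [two_le hm, ← hτ0, ← hτ1] at hi
        simpa only [ne_eq, Equiv.symm_apply_eq] using hi
      refine ⟨f.reindex σ, ξ₁.reindex τ, μ, fun a => ⟪meanCurv e β, ξ₁.reindex τ a⟫, ?_⟩
      simp only [hf0, hf1, hx0, hx1, hC, LinearMap.add_apply, LinearMap.smul_apply,
        LinearMap.id_apply, h1, h2, h4, h5, OrthonormalBasis.reindex_apply]
      refine ⟨by module, by module, fun i hi => ?_, by module, trivial, fun i hi => ?_,
        fun i hi => ?_⟩
      · rw [h3 _ (hσ i hi).1 (hσ i hi).2, zero_add]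
      · rw [h6 _ (hσ i hi).1 (hσ i hi).2, zero_add]
      · rw [h0 _ (hτ i hi).1 (hτ i hi).2, zero_add]
  · rintro ⟨e', ξ', μ, lam, h1, h2, h3, h4, h5, h6, h7⟩
    have htr : ∀ a, ∑ i, (⟪shapeOp β (ξ' a) (e' i), e' i⟫ - lam a) = 0 →
        ⟪meanCurv e β, ξ' a⟫ = lam a := by
      intro a ha
      have h0 : ∑ i, ⟪C (ξ' a) (e' i), e' i⟫ = 0 :=
        (sum_inner_map_eq e' e (C (ξ' a)) LinearMap.id).trans (hC₀ _)
      simp only [hC, LinearMap.add_apply, LinearMap.smul_apply, LinearMap.id_apply,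
        inner_add_left, real_inner_smul_left, real_inner_self_eq_norm_sq, e'.norm_eq_one,
        Finset.sum_sub_distrib, Finset.sum_add_distrib, h0] at ha
      simp only [one_pow, mul_one, Finset.sum_const, Finset.card_univ, Fintype.card_fin,
        nsmul_eq_mul, zero_add, ← mul_sub] at ha
      have hn0 : (n : ℝ) ≠ 0 := Nat.cast_ne_zero.2 (by omega)
      exact sub_eq_zero.1 ((mul_eq_zero.1 ha).resolve_left hn0)
    have hlam : ∀ a, ⟪meanCurv e β, ξ' a⟫ = lam a := by
      intro a
      refine htr a ?_
      by_cases ha0 : a = ⟨0, by omega⟩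
      · subst ha0
        rw [Fintype.sum_eq_add _ _ hn01 (fun i hi => by
          rw [h3 i ((two_le hn i).2 hi), real_inner_smul_left, real_inner_self_eq_norm_sq,
            e'.norm_eq_one]; ring), h1, h2]
        simp only [real_inner_smul_left, real_inner_self_eq_norm_sq, e'.norm_eq_one]
        ring
      by_cases ha1 : a = ⟨1, by omega⟩
      · subst ha1
        rw [Fintype.sum_eq_add _ _ hn01 (fun i hi => by
          rw [h6 i ((two_le hn i).2 hi), real_inner_smul_left, real_inner_self_eq_norm_sq,
            e'.norm_eq_one]; ring), h4, h5]
        simp only [inner_add_left, real_inner_smul_left, real_inner_self_eq_norm_sq,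
          e'.norm_eq_one, e'.inner_eq_zero hn01, e'.inner_eq_zero hn01.symm]
        ring
      · rw [h7 a ((two_le hm a).2 ⟨ha0, ha1⟩)]
        simp [real_inner_smul_left]
    have hCeq : ∀ a x, C (ξ' a) x = shapeOp β (ξ' a) x - lam a • x := fun a x => by
      rw [hC, ← hlam]; simp
    rw [rho_eq_iff hn hC hC₀ c e' ξ']
    obtain ⟨s1, s2⟩ := sums_of_pair (C := fun a => C (ξ' a)) (f := e') (μ := μ) hm01
      (fun c h h' => LinearMap.ext fun x => by
        rw [hCeq, h7 c ((two_le hm c).2 ⟨h, h'⟩)]; simp)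
      hn01 (by rw [hCeq, h1]; module) (by rw [hCeq, h2]; module)
      (fun u h h' => by rw [hCeq, h3 u ((two_le hn u).2 ⟨h, h'⟩), sub_self])
      (by rw [hCeq, h4]; module) (by rw [hCeq, h5]; module)
      (fun u h h' => by rw [hCeq, h6 u ((two_le hn u).2 ⟨h, h'⟩), sub_self])
    rw [s1, s2]

end Paper
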